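/- Let C be a closed symmetric monoidal category with tensor unit 𝟙, and let (A, m, u) be a monoid object in C such that the iterated canonical pairing maps μ_n(A) : (A^∨)^{⊗n} → (A^{⊗n})^∨ are isomorphisms for all n ≥ 0 (Condition 1) and the canonical map η_A : A → A^∨∨ is an isomorphism (Condition 2), i.e., A is quasi-proper. Equip A^∨ with the comonoid structure whose comultiplication is μ_{A,A}^{-1} ∘ m^∨ and whose counit is μ_0^{-1} ∘ u^∨, and equip (A^∨)^∨ with the monoid structure dual to this comonoid structure (multiplication Δ^∨ ∘ μ_{A^∨,A^∨}, unit ε^∨ ∘ μ_0). Then η_A : A → (A^∨)^∨ is an isomorphism of monoid objects, i.e., it is an isomorphism in C compatible with the multiplications and units. (1-categorical core of the paper's Theorem on the anti-equivalence between quasi-proper algebras and coalgebras.) -/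

import Mathlib

set_option linter.unusedSectionVars false

open CategoryTheory MonoidalCategory MonoidalClosed

universe v u

namespace CoTHHFormal

variable (C : Type u) [Category.{v} C] [MonoidalCategory C] [SymmetricCategory C]
  [MonoidalClosed C]

/-- The linear dual of an object: `X^∨ = [X, 𝟙]`. -/
def dual (X : C) : C := (ihom X).obj (𝟙_ C)

variable {C}

/-- The linear dual of a morphism, acting contravariantly by precomposition in the
internal hom. -/
def dualMap {X Y : C} (f : X ⟶ Y) : dual C Y ⟶ dual C X :=
  (MonoidalClosed.pre f).app (𝟙_ C)

@[simp] lemma dualMap_id (X : C) : dualMap (𝟙 X) = 𝟙 (dual C X) := by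
  simp [dualMap, dual]

@[simp] lemma dualMap_comp {X Y Z : C} (f : X ⟶ Y) (g : Y ⟶ Z) :
    dualMap (f ≫ g) = dualMap g ≫ dualMap f := by
  simp [dualMap]
  rfl

variable (C)

/-- The evaluation map `X ⊗ X^∨ ⟶ 𝟙`. -/
def ev (X : C) : X ⊗ dual C X ⟶ 𝟙_ C := (ihom.ev X).app (𝟙_ C)

/-- The canonical map `η_X : X ⟶ X^∨∨`, adjoint under the tensor-hom adjunction to the
composite `X^∨ ⊗ X ≅ X ⊗ X^∨ → 𝟙` of the symmetry with the evaluation map. -/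
def eta (X : C) : X ⟶ dual C (dual C X) :=
  MonoidalClosed.curry ((β_ (dual C X) X).hom ≫ ev C X)

/-- The canonical pairing map `μ_{X,Y} : X^∨ ⊗ Y^∨ ⟶ (X ⊗ Y)^∨`, adjoint to the composite
of the symmetry rearrangement with the two evaluation maps. -/
def pairing (X Y : C) : dual C X ⊗ dual C Y ⟶ dual C (X ⊗ Y) :=
  MonoidalClosed.curry
    (tensorμ X Y (dual C X) (dual C Y) ≫ (ev C X ⊗ₘ ev C Y) ≫ (λ_ (𝟙_ C)).hom)

/-- The canonical map `μ_0 : 𝟙 ⟶ 𝟙^∨`. -/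
def pairingUnit : 𝟙_ C ⟶ dual C (𝟙_ C) :=
  MonoidalClosed.curry (λ_ (𝟙_ C)).hom

/-- Tensor powers of an object: `X^{⊗0} = 𝟙` and `X^{⊗(n+1)} = X^{⊗n} ⊗ X`. -/
def tpow (X : C) : ℕ → C
  | 0 => 𝟙_ C
  | n + 1 => tpow X n ⊗ X

/-- The iterated canonical pairing maps `μ_n(X) : (X^∨)^{⊗n} ⟶ (X^{⊗n})^∨`,
the lax monoidal structure maps of the linear dual functor. -/
def pairingPow (X : C) : (n : ℕ) → (tpow C (dual C X) n ⟶ dual C (tpow C X n))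
  | 0 => pairingUnit C
  | n + 1 => (pairingPow X n ▷ dual C X) ≫ pairing C (tpow C X n) X

/-- An object is dualizable if it admits an exact pairing with some object. -/
def Dualizable (X : C) : Prop := ∃ Y : C, Nonempty (ExactPairing X Y)

variable {C}

lemma whiskerLeft_curry_ev {X Y : C} (f : X ⊗ Y ⟶ 𝟙_ C) :
    X ◁ (curry f : Y ⟶ dual C X) ≫ ev C X = f :=
  whiskerLeft_curry_ihom_ev_app _ _ _

lemma whiskerLeft_dualMap_ev {X Y : C} (f : X ⟶ Y) :
    X ◁ dualMap f ≫ ev C X = f ▷ dual C Y ≫ ev C Y :=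
  id_tensor_pre_app_comp_ev _ _

lemma dual_hom_ext {X Y : C} {f g : Y ⟶ dual C X}
    (h : X ◁ f ≫ ev C X = X ◁ g ≫ ev C X) : f = g :=
  uncurry_injective h

lemma whiskerLeft_eta_ev (X : C) :
    dual C X ◁ eta C X ≫ ev C (dual C X) = (β_ (dual C X) X).hom ≫ ev C X :=
  whiskerLeft_curry_ev _

lemma whiskerLeft_pairing_ev (X Y : C) :
    (X ⊗ Y) ◁ pairing C X Y ≫ ev C (X ⊗ Y) =
      tensorμ X Y (dual C X) (dual C Y) ≫ (ev C X ⊗ₘ ev C Y) ≫ (λ_ (𝟙_ C)).hom :=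
  whiskerLeft_curry_ev _

lemma whiskerLeft_pairingUnit_ev :
    𝟙_ C ◁ pairingUnit C ≫ ev C (𝟙_ C) = (λ_ (𝟙_ C)).hom :=
  whiskerLeft_curry_ev _

/-- The double dual map is natural. -/
lemma eta_naturality {X Y : C} (f : X ⟶ Y) :
    f ≫ eta C Y = eta C X ≫ dualMap (dualMap f) := by
  apply dual_hom_ext
  rw [MonoidalCategory.whiskerLeft_comp, MonoidalCategory.whiskerLeft_comp, Category.assoc,
    Category.assoc, whiskerLeft_eta_ev, whiskerLeft_dualMap_ev, whisker_exchange_assoc,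
    whiskerLeft_eta_ev, BraidedCategory.braiding_naturality_left_assoc, whiskerLeft_dualMap_ev,
    BraidedCategory.braiding_naturality_right_assoc]

/-- The pairing is natural in both variables. -/
lemma pairing_naturality {X X' Y Y' : C} (f : X ⟶ X') (g : Y ⟶ Y') :
    (dualMap f ⊗ₘ dualMap g) ≫ pairing C X Y = pairing C X' Y' ≫ dualMap (f ⊗ₘ g) := by
  apply dual_hom_ext
  rw [MonoidalCategory.whiskerLeft_comp, MonoidalCategory.whiskerLeft_comp, Category.assoc,
    Category.assoc, whiskerLeft_pairing_ev, whiskerLeft_dualMap_ev, whisker_exchange_assoc,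
    whiskerLeft_pairing_ev, reassoc_of% tensorμ_natural_right,
    reassoc_of% tensorμ_natural_left]
  simp only [tensorHom_comp_tensorHom_assoc, whiskerLeft_dualMap_ev]

lemma tensorμ_comp_braiding (X Y Z W : C) :
    tensorμ X Y Z W ≫ ((β_ X Z).hom ⊗ₘ (β_ Y W).hom) =
      (β_ (X ⊗ Y) (Z ⊗ W)).hom ≫ tensorμ Z W X Y := by
  simp [tensorμ, SymmetricCategory.braiding_swap_eq_inv_braiding W X,
    MonoidalCategory.tensorHom_def]

/-- The double dual map is compatible with the pairings. -/
lemma eta_tensor_pairing (X Y : C) :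
    (eta C X ⊗ₘ eta C Y) ≫ pairing C (dual C X) (dual C Y) =
      eta C (X ⊗ Y) ≫ dualMap (pairing C X Y) := by
  apply dual_hom_ext
  rw [MonoidalCategory.whiskerLeft_comp, MonoidalCategory.whiskerLeft_comp, Category.assoc,
    Category.assoc, whiskerLeft_pairing_ev, whiskerLeft_dualMap_ev, whisker_exchange_assoc,
    whiskerLeft_eta_ev, BraidedCategory.braiding_naturality_left_assoc, whiskerLeft_pairing_ev,
    ← Category.assoc, tensorμ_natural_right, ← reassoc_of% tensorμ_comp_braiding]
  simp only [Category.assoc, tensorHom_comp_tensorHom_assoc, whiskerLeft_eta_ev]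

lemma eta_unit : eta C (𝟙_ C) ≫ dualMap (pairingUnit C) = pairingUnit C := by
  apply dual_hom_ext
  rw [MonoidalCategory.whiskerLeft_comp, Category.assoc, whiskerLeft_dualMap_ev,
    whisker_exchange_assoc, whiskerLeft_eta_ev, BraidedCategory.braiding_naturality_left_assoc,
    whiskerLeft_pairingUnit_ev, braiding_leftUnitor, unitors_equal]

instance isIso_dualMap {X Y : C} (f : X ⟶ Y) [IsIso f] : IsIso (dualMap f) :=
  ⟨dualMap (inv f), by simp [← dualMap_comp], by simp [← dualMap_comp]⟩

/-- If the first two iterated pairing maps of `X` are isomorphisms, so is the pairing `μ_{X,X}`. -/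
lemma isIso_pairing_of_isIso_pairingPow (X : C) (h₁ : IsIso (pairingPow C X 1))
    (h₂ : IsIso (pairingPow C X 2)) : IsIso (pairing C X X) := by
  have : IsIso (pairingPow C X 1 ▷ dual C X ≫ pairing C (𝟙_ C ⊗ X) X) := h₂
  have : IsIso (pairing C (𝟙_ C ⊗ X) X) :=
    IsIso.of_isIso_comp_left (pairingPow C X 1 ▷ dual C X) _
  have e := pairing_naturality (λ_ X).hom (𝟙 X)
  have : IsIso (pairing C X X ≫ dualMap ((λ_ X).hom ⊗ₘ 𝟙 X)) := by
    rw [← e, dualMap_id]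
    infer_instance
  exact IsIso.of_isIso_comp_right _ (dualMap ((λ_ X).hom ⊗ₘ 𝟙 X))

variable (C)

/-- Let `(A, m, u)` be a quasi-proper monoid object (Condition 1: all iterated canonical
pairing maps `μ_n(A)` are isomorphisms; Condition 2: `η_A` is an isomorphism). Equip `A^∨`
with the comonoid structure `Δ = m^∨ ≫ μ_{A,A}⁻¹`, `ε = u^∨ ≫ μ_0⁻¹`, and equip `A^∨∨`
with the dual monoid structure (multiplication `μ_{A^∨,A^∨} ≫ Δ^∨`, unit `μ_0 ≫ ε^∨`).
Then `η_A : A ⟶ A^∨∨` is an isomorphism of monoid objects: it is an isomorphism in `C`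
compatible with the multiplications and the units. -/
theorem eta_is_monoid_iso_of_quasi_proper (M : Mon C)
    (h1 : ∀ n : ℕ, IsIso (pairingPow C M.X n)) (h2 : IsIso (eta C M.X)) :
    ∃ (p : dual C (M.X ⊗ M.X) ⟶ dual C M.X ⊗ dual C M.X)
      (q : dual C (𝟙_ C) ⟶ 𝟙_ C),
      pairing C M.X M.X ≫ p = 𝟙 (dual C M.X ⊗ dual C M.X) ∧
      p ≫ pairing C M.X M.X = 𝟙 (dual C (M.X ⊗ M.X)) ∧
      pairingUnit C ≫ q = 𝟙 (𝟙_ C) ∧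
      q ≫ pairingUnit C = 𝟙 (dual C (𝟙_ C)) ∧
      (let Δ : dual C M.X ⟶ dual C M.X ⊗ dual C M.X := dualMap M.mon.mul ≫ p
       let ε : dual C M.X ⟶ 𝟙_ C := dualMap M.mon.one ≫ q
       let mul' : dual C (dual C M.X) ⊗ dual C (dual C M.X) ⟶ dual C (dual C M.X) :=
         pairing C (dual C M.X) (dual C M.X) ≫ dualMap Δ
       let one' : 𝟙_ C ⟶ dual C (dual C M.X) := pairingUnit C ≫ dualMap ε
       IsIso (eta C M.X) ∧
       (eta C M.X ⊗ₘ eta C M.X) ≫ mul' = M.mon.mul ≫ eta C M.X ∧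
       M.mon.one ≫ eta C M.X = one') := by
  have hp := isIso_pairing_of_isIso_pairingPow M.X (h1 1) (h1 2)
  have hq : IsIso (pairingUnit C) := h1 0
  refine ⟨inv (pairing C M.X M.X), inv (pairingUnit C), by simp, by simp, by simp, by simp,
    h2, ?_, ?_⟩
  · rw [dualMap_comp, ← Category.assoc, ← Category.assoc, eta_tensor_pairing, eta_naturality,
      Category.assoc (eta C _), ← dualMap_comp, IsIso.inv_hom_id, dualMap_id, Category.comp_id]
  · rw [eta_naturality, dualMap_comp, ← Category.assoc]
    congr 1
    rw [← cancel_mono (dualMap (pairingUnit C)), eta_unit, Category.assoc, ← dualMap_comp,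
      IsIso.hom_inv_id, dualMap_id, Category.comp_id]

end CoTHHFormal
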